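/- Let p ∈ (10/3, 6) and c > 0. If {u_k} ⊂ S_r(c) is a sequence such that {F(u_k)} is bounded and Q(u_k) → 0, then sup_k A(u_k) < ∞ and sup_k B(u_k) < ∞; in particular {u_k} is bounded in H¹(ℝ³). -/

import Mathlib

open MeasureTheory Filter
open scoped InnerProductSpace Topology

noncomputable section

/-- `ℝ³`. -/
abbrev R3 : Type := EuclideanSpace ℝ (Fin 3)

/-- `A(u) = ∫_{ℝ³} |∇u|² dx`. -/
def funA (u : R3 → ℝ) : ℝ := ∫ x, ‖gradient u x‖ ^ 2

/-- `B(u) = ∫∫ |u(x)|²|u(y)|²/|x−y| dx dy`. -/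
def funB (u : R3 → ℝ) : ℝ := ∫ x, ∫ y, (u x) ^ 2 * (u y) ^ 2 / dist x y

/-- `C(u) = ∫ |u|^p dx`. -/
def funC (p : ℝ) (u : R3 → ℝ) : ℝ := ∫ x, |u x| ^ p

/-- `D(u) = ∫ |u|² dx`. -/
def funD (u : R3 → ℝ) : ℝ := ∫ x, (u x) ^ 2

/-- the energy functional `F`. -/
def funF (p : ℝ) (u : R3 → ℝ) : ℝ := funA u / 2 + funB u / 4 - funC p u / p

/-- the Pohozaev-type functional `Q`. -/
def funQ (p : ℝ) (u : R3 → ℝ) : ℝ :=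
  funA u + funB u / 4 - (3 * (p - 2) / (2 * p)) * funC p u

/-- radial symmetry. -/
def IsRadial (u : R3 → ℝ) : Prop := ∀ x y : R3, ‖x‖ = ‖y‖ → u x = u y

/-- membership in `H¹(ℝ³)` (formalized via the classical gradient). -/
def InH1 (u : R3 → ℝ) : Prop :=
  MemLp u 2 (volume : Measure R3) ∧
    MemLp (fun x => gradient u x) 2 (volume : Measure R3)

/-- membership in `H¹_r(ℝ³)`. -/
def InH1r (u : R3 → ℝ) : Prop := InH1 u ∧ IsRadial u

/-- the `H¹` inner product. -/
def innerH1 (u v : R3 → ℝ) : ℝ :=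
  (∫ x, ⟪gradient u x, gradient v x⟫_ℝ) + ∫ x, u x * v x

/-- the `L²` inner product. -/
def innerL2 (u v : R3 → ℝ) : ℝ := ∫ x, u x * v x

/-- squared `H¹` norm. -/
def normH1Sq (u : R3 → ℝ) : ℝ := funA u + funD u

/-- `u ≠ 0` as an element of `H¹` (i.e. not a.e. zero). -/
def Nontriv (u : R3 → ℝ) : Prop := ¬ (u =ᵐ[(volume : Measure R3)] fun _ => (0 : ℝ))

/-- membership in the sphere `S_r(c)`. -/
def InSr (c : ℝ) (u : R3 → ℝ) : Prop := InH1r u ∧ funD u = c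

/-- membership in `S_r(c) ∩ W`. -/
def InSrV (c : ℝ) (W : Submodule ℝ (R3 → ℝ)) (u : R3 → ℝ) : Prop :=
  InSr c u ∧ u ∈ W

/-- the scaling `κ(u,θ)(x) = e^{3θ/2} u(e^θ x)`. -/
def kappa (u : R3 → ℝ) (θ : ℝ) : R3 → ℝ :=
  fun x => Real.exp (3 * θ / 2) * u (Real.exp θ • x)

/-- the pairing `⟨-Δu - λu + (|x|⁻¹ ∗ |u|²)u - |u|^{p-2}u, w⟩`. -/
def pairing (p lam : ℝ) (u w : R3 → ℝ) : ℝ :=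
  (∫ x, ⟪gradient u x, gradient w x⟫_ℝ) - lam * (∫ x, u x * w x)
    + (∫ x, ∫ y, (u x) ^ 2 * u y * w y / dist x y)
    - ∫ x, |u x| ^ (p - 2) * u x * w x

/-- `(u, λ)` is a weak (`H¹`) solution of `-Δu - λu + (|x|⁻¹ ∗ |u|²)u - |u|^{p-2}u = 0`. -/
def IsWeakSolution (p lam : ℝ) (u : R3 → ℝ) : Prop :=
  ∀ w, InH1r w → pairing p lam u w = 0

/-- the `H⁻¹_r` norm of `-Δu - λu + (|x|⁻¹ ∗ |u|²)u - |u|^{p-2}u`. -/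
def dualSup (p lam : ℝ) (u : R3 → ℝ) : ℝ :=
  sSup {r | ∃ w, InH1r w ∧ normH1Sq w ≤ 1 ∧ r = |pairing p lam u w|}

/-- the norm of the restriction of `F'(u)` to the tangent space of `S_r(c)` at `u`. -/
def restrDerivSup (p : ℝ) (u : R3 → ℝ) : ℝ :=
  sSup {r | ∃ w, InH1r w ∧ innerL2 u w = 0 ∧ normH1Sq w ≤ 1 ∧ r = |pairing p 0 u w|}

/-- weak convergence in `H¹_r`. -/
def WeakH1Conv (u : ℕ → R3 → ℝ) (v : R3 → ℝ) : Prop :=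
  ∀ w, InH1r w → Tendsto (fun k => innerH1 (u k) w) atTop (𝓝 (innerH1 v w))

/-- strong convergence in `H¹_r`. -/
def StrongH1Conv (u : ℕ → R3 → ℝ) (v : R3 → ℝ) : Prop :=
  Tendsto (fun k => normH1Sq (u k - v)) atTop (𝓝 0)

/-- `{Vₙ}` is a strictly increasing sequence of finite-dimensional subspaces of
`H¹_r(ℝ³)` whose union is dense in `H¹_r(ℝ³)`. -/
def IsFiltrationH1r (V : ℕ → Submodule ℝ (R3 → ℝ)) : Prop :=
  (∀ n, FiniteDimensional ℝ (V n)) ∧ (∀ n, V n < V (n + 1)) ∧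
    (∀ n, ∀ u ∈ V n, InH1r u) ∧
    (∀ u, InH1r u → ∀ ε > 0, ∃ n, ∃ v ∈ V n, normH1Sq (u - v) < ε)

/-- `u` belongs to the `H¹`-orthogonal complement of `W`. -/
def PerpH1 (W : Submodule ℝ (R3 → ℝ)) (u : R3 → ℝ) : Prop :=
  ∀ v ∈ W, innerH1 u v = 0

/-- the set of Rayleigh-type quotients whose infimum is `μₙ`. -/
def muSet (p : ℝ) (W : Submodule ℝ (R3 → ℝ)) : Set ℝ :=
  {r | ∃ u, InH1r u ∧ PerpH1 W u ∧ Nontriv u ∧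
    r = normH1Sq u / funC p u ^ ((2 : ℝ) / p)}

/-- the set whose greatest element is `L = max_{x>0} (x²+c)^{p/2}/(x^p + c^{p/2})`. -/
def Lset (p c : ℝ) : Set ℝ :=
  {r | ∃ x : ℝ, 0 < x ∧ r = (x ^ 2 + c) ^ (p / 2) / (x ^ p + c ^ (p / 2))}

/-- the set `Bₙ = {u ∈ V_{n-1}^⊥ ∩ S_r(c) : ‖∇u‖² = ρ}`. -/
def BnSet (p c ρ : ℝ) (W : Submodule ℝ (R3 → ℝ)) : Set (R3 → ℝ) :=
  {u | InH1r u ∧ PerpH1 W u ∧ funD u = c ∧ funA u = ρ}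

/-- the map `ḡ(t,u) = κ(u, (2t-1)θn)`. -/
def gbar (θn t : ℝ) (u : R3 → ℝ) : R3 → ℝ := kappa u ((2 * t - 1) * θn)

/-- `θn > 0` realizes the boundary conditions of the linking construction. -/
def ThetaGood (p c θn ρ b : ℝ) (W : Submodule ℝ (R3 → ℝ)) : Prop :=
  0 < θn ∧ ∀ u, InSrV c W u →
    funA (gbar θn 0 u) < ρ ∧ ρ < funA (gbar θn 1 u) ∧
      funF p (gbar θn 0 u) < b ∧ funF p (gbar θn 1 u) < b

/-- membership in the class `Γₙ`. -/
def InGamma (p c θn : ℝ) (W : Submodule ℝ (R3 → ℝ))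
    (g : ℝ → (R3 → ℝ) → R3 → ℝ) : Prop :=
  (∀ t ∈ Set.Icc (0 : ℝ) 1, ∀ u, InSrV c W u → InSr c (g t u)) ∧
  (∀ t ∈ Set.Icc (0 : ℝ) 1, ∀ u, InSrV c W u → ∀ ε > 0, ∃ δ > 0,
    ∀ t' ∈ Set.Icc (0 : ℝ) 1, ∀ u', InSrV c W u' →
      |t' - t| < δ → normH1Sq (u' - u) < δ → normH1Sq (g t' u' - g t u) < ε) ∧
  (∀ t ∈ Set.Icc (0 : ℝ) 1, ∀ u, InSrV c W u → g t (-u) = -(g t u)) ∧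
  (∀ u, InSrV c W u → g 0 u = gbar θn 0 u ∧ g 1 u = gbar θn 1 u)

/-- `max_{(t,u) ∈ [0,1] × (S_r(c)∩W)} F(g(t,u))`. -/
def maxFOn (p c : ℝ) (W : Submodule ℝ (R3 → ℝ)) (g : ℝ → (R3 → ℝ) → R3 → ℝ) : ℝ :=
  sSup {r | ∃ t ∈ Set.Icc (0 : ℝ) 1, ∃ u, InSrV c W u ∧ r = funF p (g t u)}

/-- the min-max value `γₙ(c)`. -/
def gammaVal (p c θn : ℝ) (W : Submodule ℝ (R3 → ℝ)) : ℝ :=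
  sInf {m | ∃ g, InGamma p c θn W g ∧ m = maxFOn p c W g}

/-- membership in the class `Γ̃ₙ` of maps into `S_r(c) × ℝ`. -/
def InGammaT (p c θn : ℝ) (W : Submodule ℝ (R3 → ℝ))
    (gt : ℝ → (R3 → ℝ) → (R3 → ℝ) × ℝ) : Prop :=
  (∀ t ∈ Set.Icc (0 : ℝ) 1, ∀ u, InSrV c W u → InSr c (gt t u).1) ∧
  (∀ t ∈ Set.Icc (0 : ℝ) 1, ∀ u, InSrV c W u → ∀ ε > 0, ∃ δ > 0,
    ∀ t' ∈ Set.Icc (0 : ℝ) 1, ∀ u', InSrV c W u' →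
      |t' - t| < δ → normH1Sq (u' - u) < δ →
        normH1Sq ((gt t' u').1 - (gt t u).1) + ((gt t' u').2 - (gt t u).2) ^ 2 < ε) ∧
  (∀ t ∈ Set.Icc (0 : ℝ) 1, ∀ u, InSrV c W u →
    (gt t (-u)).1 = -((gt t u).1) ∧ (gt t (-u)).2 = (gt t u).2) ∧
  InGamma p c θn W (fun t u => kappa (gt t u).1 (gt t u).2)

/-- `max_{(t,u)} F̃(g̃(t,u))`, where `F̃(u,θ) = F(κ(u,θ))`. -/
def maxFTOn (p c : ℝ) (W : Submodule ℝ (R3 → ℝ))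
    (gt : ℝ → (R3 → ℝ) → (R3 → ℝ) × ℝ) : ℝ :=
  sSup {r | ∃ t ∈ Set.Icc (0 : ℝ) 1, ∃ u, InSrV c W u ∧
    r = funF p (kappa (gt t u).1 (gt t u).2)}

/-- the auxiliary min-max value `γ̃ₙ(c)`. -/
def gammaTVal (p c θn : ℝ) (W : Submodule ℝ (R3 → ℝ)) : ℝ :=
  sInf {m | ∃ gt, InGammaT p c θn W gt ∧ m = maxFTOn p c W gt}

/-- the pairing `⟨F̃'(u,θ), (z₁,z₂)⟩` on `E = H¹_r(ℝ³) × ℝ`. -/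
def FtPair (p : ℝ) (u : R3 → ℝ) (θ : ℝ) (z₁ : R3 → ℝ) (z₂ : ℝ) : ℝ :=
  Real.exp (2 * θ) * (∫ x, ⟪gradient u x, gradient z₁ x⟫_ℝ)
    + Real.exp θ * (∫ x, ∫ y, (u x) ^ 2 * u y * z₁ y / dist x y)
    - Real.exp (3 * (p - 2) * θ / 2) * (∫ x, |u x| ^ (p - 2) * u x * z₁ x)
    + z₂ * funQ p (kappa u θ)

/-- sequences on `S_r(c)` with bounded energy and `Q(u_k) → 0` are
bounded in `H¹`. -/
theorem PS_sequence_bounded (p c : ℝ) (hp : 10 / 3 < p) (hp' : p < 6) (hc : 0 < c)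
    (u : ℕ → R3 → ℝ) (hu : ∀ k, InSr c (u k))
    (hF : ∃ M : ℝ, ∀ k, |funF p (u k)| ≤ M)
    (hQ : Tendsto (fun k => funQ p (u k)) atTop (𝓝 0)) :
    (∃ M : ℝ, ∀ k, funA (u k) ≤ M) ∧
    (∃ M : ℝ, ∀ k, funB (u k) ≤ M) ∧
    ∃ M : ℝ, ∀ k, normH1Sq (u k) ≤ M := by
  obtain ⟨M, hM⟩ := hF
  obtain ⟨N, hN⟩ := hQ.norm.bddAbove_range
  have hN' : ∀ k, |funQ p (u k)| ≤ N := fun k => hN ⟨k, rfl⟩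
  have hA : ∀ k, 0 ≤ funA (u k) := fun k => integral_nonneg fun x => by positivity
  have hB : ∀ k, 0 ≤ funB (u k) := fun k =>
    integral_nonneg fun x => integral_nonneg fun y => by positivity
  have hp0 : 0 < p := by linarith
  have hp2 : 0 < p - 2 := by linarith
  obtain ⟨s, hs⟩ : ∃ s : ℝ, s = 2 / (3 * (p - 2)) := ⟨_, rfl⟩
  have hs0 : 0 < s := by rw [hs]; positivity
  have hs1 : s < 1 / 2 := by
    rw [hs, div_lt_div_iff₀ (by positivity) (by norm_num)]; linarith
  have key : ∀ k, (1 / 2 - s) * funA (u k) + (1 - s) / 4 * funB (u k) ≤ M + s * N := by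
    intro k
    have e : (1 / 2 - s) * funA (u k) + (1 - s) / 4 * funB (u k)
        = funF p (u k) - s * funQ p (u k) := by
      have h1 : s * (3 * (p - 2) / (2 * p)) = 1 / p := by rw [hs]; field_simp
      unfold funF funQ
      linear_combination (-(funC p (u k))) * h1
    rw [e]
    have h1 := (abs_le.1 (hM k)).2
    have h2 := (abs_le.1 (hN' k)).1
    nlinarith
  have bA : ∀ k, funA (u k) ≤ (M + s * N) / (1 / 2 - s) := by
    intro k
    rw [le_div_iff₀ (by linarith)]
    have := key k
    have := mul_nonneg (show 0 ≤ (1 - s) / 4 by linarith) (hB k)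
    linarith
  have bB : ∀ k, funB (u k) ≤ (M + s * N) / ((1 - s) / 4) := by
    intro k
    rw [le_div_iff₀ (by linarith)]
    have := key k
    have := mul_nonneg (show 0 ≤ 1 / 2 - s by linarith) (hA k)
    linarith
  refine ⟨⟨_, bA⟩, ⟨_, bB⟩, ⟨(M + s * N) / (1 / 2 - s) + c, fun k => ?_⟩⟩
  unfold normH1Sq
  rw [(hu k).2]
  linarith [bA k]
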